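/- In the multi-server secure aggregation model, any scheme satisfying the structural and correctness constraints (security not required) has message lengths L_X ≥ L and L_Y ≥ L; equivalently, the communication rates satisfy R_X ≥ 1 and R_Y ≥ 1. -/

import Mathlib

open Finset

open scoped Classical

noncomputable section

/-- Probability that the random variable `X` takes the value `s`, under the weights `μ`. -/
def prb {Ω : Type} [Fintype Ω] (μ : Ω → ℝ) {α : Type} (X : Ω → α) (s : α) : ℝ :=
  ∑ ω ∈ Finset.univ.filter fun ω => X ω = s, μ ω

/-- Shannon entropy of `X` in `q`-ary units. -/
def ent (q : ℕ) {Ω : Type} [Fintype Ω] (μ : Ω → ℝ) {α : Type} [Fintype α] (X : Ω → α) : ℝ :=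
  -∑ s : α, prb μ X s * Real.logb q (prb μ X s)

/-- Conditional entropy `H(X | Y)` in `q`-ary units. -/
def condEnt (q : ℕ) {Ω : Type} [Fintype Ω] (μ : Ω → ℝ) {α β : Type} [Fintype α] [Fintype β]
    (X : Ω → α) (Y : Ω → β) : ℝ :=
  ent q μ (fun ω => (X ω, Y ω)) - ent q μ Y

/-- Conditional mutual information `I(X ; Y ∣ Z)` in `q`-ary units. -/
def mutInfo (q : ℕ) {Ω : Type} [Fintype Ω] (μ : Ω → ℝ) {α β γ : Type}
    [Fintype α] [Fintype β] [Fintype γ] (X : Ω → α) (Y : Ω → β) (Z : Ω → γ) : ℝ :=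
  condEnt q μ X Z - condEnt q μ X fun ω => (Y ω, Z ω)

/-- The joint random variable formed by the members of a family of random variables
indexed by a finset. -/
def restr {Ω ι α : Type} (Z : ι → Ω → α) (T : Finset ι) : Ω → { i // i ∈ T } → α :=
  fun ω i => Z i.1 ω

/-- The set of users `𝒦`: user `⟨u,v⟩` is the `v`-th user of server `u`. -/
abbrev Usr (U : ℕ) (V : Fin U → ℕ) : Type := Σ u : Fin U, Fin (V u)

/-- Total number of users, `K = ∑ u, V u`. -/
def Ktot (U : ℕ) (V : Fin U → ℕ) : ℕ := ∑ u, V u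

/-- The users connected to server `u`, `𝒦_{{u}}`. -/
def Ksrv (U : ℕ) (V : Fin U → ℕ) (u : Fin U) : Finset (Usr U V) :=
  Finset.univ.filter fun i => i.1 = u

/-- The users connected to a set of servers, `𝒦_𝒰`. -/
def KsrvSet (U : ℕ) (V : Fin U → ℕ) (A : Finset (Fin U)) : Finset (Usr U V) :=
  Finset.univ.filter fun i => i.1 ∈ A

/-- The set of servers `𝒰^{(m,n)}` associated with a security input set `Sm` and a
colluding set `Tn`. -/
def UServers (U : ℕ) (V : Fin U → ℕ) (Sm Tn : Finset (Usr U V)) : Finset (Fin U) :=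
  Finset.univ.filter fun u =>
    (Sm ∩ Ksrv U V u).Nonempty ∧ ((Sm ∪ Tn) ∩ Ksrv U V u).card = V u

/-- The set `(𝒮_m ∩ 𝒦_{{u}}) ∪ 𝒦_{𝒰^{(m,n)}} ∪ 𝒯_n`. -/
def BigB (U : ℕ) (V : Fin U → ℕ) (Sm Tn : Finset (Usr U V)) (u : Fin U) : Finset (Usr U V) :=
  (Sm ∩ Ksrv U V u) ∪ KsrvSet U V (UServers U V Sm Tn) ∪ Tn

/-- The implicit security input set `𝒮_I`. -/
def SImp (U : ℕ) (V : Fin U → ℕ) {M N : ℕ} (S : Fin M → Finset (Usr U V))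
    (T : Fin N → Finset (Usr U V)) : Finset (Usr U V) :=
  Finset.univ.filter fun i =>
    (∀ m, i ∉ S m) ∧
    ∃ u m n, (BigB U V (S m) (T n) u).card = Ktot U V - 1 ∧ i ∉ BigB U V (S m) (T n) u

/-- The total security input set `𝒮̄`. -/
def Sbar (U : ℕ) (V : Fin U → ℕ) {M N : ℕ} (S : Fin M → Finset (Usr U V))
    (T : Fin N → Finset (Usr U V)) : Finset (Usr U V) :=
  (Finset.univ.biUnion fun m => S m) ∪ SImp U V S T

/-- The set `𝒜_{u,m,n}`. -/
def Aset (U : ℕ) (V : Fin U → ℕ) {M N : ℕ} (S : Fin M → Finset (Usr U V))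
    (T : Fin N → Finset (Usr U V)) (u : Fin U) (m : Fin M) (n : Fin N) : Finset (Usr U V) :=
  BigB U V (S m) (T n) u ∩ Sbar U V S T

/-- `a* = max_{u,m,n} |𝒜_{u,m,n}|`. -/
def aStar (U : ℕ) (V : Fin U → ℕ) {M N : ℕ} (S : Fin M → Finset (Usr U V))
    (T : Fin N → Finset (Usr U V)) : ℕ :=
  Finset.univ.sup fun t : Fin U × Fin M × Fin N => (Aset U V S T t.1 t.2.1 t.2.2).card

/-- `|((𝒮_m ∩ 𝒦_{{u}}) ∪ 𝒯_n) ∩ 𝒮̄| + |𝒰^{(m,n)} ∖ {u}|`. -/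
def eVal (U : ℕ) (V : Fin U → ℕ) {M N : ℕ} (S : Fin M → Finset (Usr U V))
    (T : Fin N → Finset (Usr U V)) (u : Fin U) (m : Fin M) (n : Fin N) : ℕ :=
  (((S m ∩ Ksrv U V u) ∪ T n) ∩ Sbar U V S T).card + ((UServers U V (S m) (T n)).erase u).card

/-- `e* = max_{u,m,n} (|((𝒮_m ∩ 𝒦_{{u}}) ∪ 𝒯_n) ∩ 𝒮̄| + |𝒰^{(m,n)} ∖ {u}|)`. -/
def eStar (U : ℕ) (V : Fin U → ℕ) {M N : ℕ} (S : Fin M → Finset (Usr U V))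
    (T : Fin N → Finset (Usr U V)) : ℕ :=
  Finset.univ.sup fun t : Fin U × Fin M × Fin N => eVal U V S T t.1 t.2.1 t.2.2

/-- The set `𝒬_1`. -/
def Q1set (U : ℕ) (V : Fin U → ℕ) {M N : ℕ} (S : Fin M → Finset (Usr U V))
    (T : Fin N → Finset (Usr U V)) : Finset (Usr U V) :=
  (Finset.univ.filter fun t : Fin U × Fin M × Fin N =>
      (Aset U V S T t.1 t.2.1 t.2.2).card = (Sbar U V S T).card).biUnion
    fun t => BigB U V (S t.2.1) (T t.2.2) t.1

/-- The set `𝒬_2`. -/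
def Q2set (U : ℕ) (V : Fin U → ℕ) {M N : ℕ} (S : Fin M → Finset (Usr U V))
    (T : Fin N → Finset (Usr U V)) : Finset (Usr U V) :=
  (Finset.univ.filter fun t : Fin U × Fin M × Fin N =>
      eVal U V S T t.1 t.2.1 t.2.2 = eStar U V S T).biUnion
    fun t => BigB U V (S t.2.1) (T t.2.2) t.1

/-- The set `𝒬`. -/
def Qset (U : ℕ) (V : Fin U → ℕ) {M N : ℕ} (S : Fin M → Finset (Usr U V))
    (T : Fin N → Finset (Usr U V)) : Finset (Usr U V) :=
  if (Q1set U V S T).Nonempty then Q1set U V S T ∪ Q2set U V S T else ∅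

/-- A secure-aggregation scheme: all structural, distributional, correctness and
security constraints of the multi-server secure aggregation model, with entropies in
`q`-ary units for `q = |F|`. -/
def IsScheme (U : ℕ) (V : Fin U → ℕ) (M N : ℕ) (S : Fin M → Finset (Usr U V))
    (T : Fin N → Finset (Usr U V)) (F : Type) [Field F] [Fintype F]
    (Ω : Type) [Fintype Ω] (μ : Ω → ℝ) (L LX LY LZ LSig : ℕ)
    (W : Usr U V → Ω → Fin L → F) (Z : Usr U V → Ω → Fin LZ → F)
    (X : Usr U V → Ω → Fin LX → F) (Y : Fin U → Ω → Fin LY → F)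
    (ZS : Ω → Fin LSig → F) : Prop :=
  let q := Fintype.card F
  (1 ≤ L) ∧
  (∀ ω, 0 ≤ μ ω) ∧ (∑ ω, μ ω = 1) ∧
  -- each input consists of `L` i.i.d. uniform `q`-ary symbols
  (∀ i, ent q μ (W i) = L) ∧
  -- the inputs are mutually independent of each other and of all keys
  (ent q μ (fun ω => (restr W Finset.univ ω, restr Z Finset.univ ω)) =
    ent q μ (restr Z Finset.univ) + ∑ i, ent q μ (W i)) ∧
  -- the source key consists of `LSig` i.i.d. uniform `q`-ary symbols
  (ent q μ ZS = LSig) ∧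
  -- the individual keys are deterministic functions of the source key
  (condEnt q μ (restr Z Finset.univ) ZS = 0) ∧
  -- each user message is a deterministic function of its input and key
  (∀ i, condEnt q μ (X i) (fun ω => (W i ω, Z i ω)) = 0) ∧
  -- each server message is a deterministic function of its received messages
  (∀ u, condEnt q μ (Y u) (restr X (Ksrv U V u)) = 0) ∧
  -- correctness
  (∀ k, condEnt q μ (fun ω => ∑ i, W i ω)
    (fun ω => (restr Y (Finset.univ.erase k) ω, restr X (Ksrv U V k) ω)) = 0) ∧
  -- security
  (∀ k m n, mutInfo q μ
    (fun ω => (restr Y (Finset.univ.erase k) ω, restr X (Ksrv U V k) ω))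
    (restr W (S m))
    (fun ω => (∑ i, W i ω, restr W (T n) ω, restr Z (T n) ω)) = 0)

/-- A rate tuple `(R_X, R_Y, R_{Z_Σ})` is achievable. -/
def Achievable (U : ℕ) (V : Fin U → ℕ) (M N : ℕ) (S : Fin M → Finset (Usr U V))
    (T : Fin N → Finset (Usr U V)) (R : ℝ × ℝ × ℝ) : Prop :=
  ∃ (F : Type) (iF : Field F) (iFt : Fintype F) (Ω : Type) (iΩ : Fintype Ω)
    (μ : Ω → ℝ) (L LX LY LZ LSig : ℕ)
    (W : Usr U V → Ω → Fin L → F) (Z : Usr U V → Ω → Fin LZ → F)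
    (X : Usr U V → Ω → Fin LX → F) (Y : Fin U → Ω → Fin LY → F)
    (ZS : Ω → Fin LSig → F),
    R.1 = (LX : ℝ) / (L : ℝ) ∧ R.2.1 = (LY : ℝ) / (L : ℝ) ∧ R.2.2 = (LSig : ℝ) / (L : ℝ) ∧
    @IsScheme U V M N S T F iF iFt Ω iΩ μ L LX LY LZ LSig W Z X Y ZS

end

section Entropy

variable {Ω : Type} [Fintype Ω] {μ : Ω → ℝ} {α β : Type}

/-- `X` is a function of `Y` on the support of `μ`. -/
def DeterminedBy (μ : Ω → ℝ) (X : Ω → α) (Y : Ω → β) : Prop :=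
  ∀ ⦃ω ω'⦄, 0 < μ ω → 0 < μ ω' → Y ω = Y ω' → X ω = X ω'

lemma prb_nonneg (hμ : ∀ ω, 0 ≤ μ ω) (X : Ω → α) (s : α) : 0 ≤ prb μ X s :=
  Finset.sum_nonneg fun ω _ => hμ ω

lemma le_prb_apply (hμ : ∀ ω, 0 ≤ μ ω) (X : Ω → α) (ω : Ω) : μ ω ≤ prb μ X (X ω) :=
  Finset.single_le_sum (f := μ) (fun i _ => hμ i) (by simp)

lemma sum_prb_mul [Fintype α] (X : Ω → α) (g : α → ℝ) :
    ∑ s, prb μ X s * g s = ∑ ω, μ ω * g (X ω) := by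
  rw [← Finset.sum_fiberwise Finset.univ X]
  refine Finset.sum_congr rfl fun s _ => ?_
  rw [prb, Finset.sum_mul]
  refine Finset.sum_congr rfl fun ω hω => ?_
  rw [(Finset.mem_filter.mp hω).2]

lemma sum_prb [Fintype α] (X : Ω → α) : ∑ s, prb μ X s = ∑ ω, μ ω := by
  simpa using sum_prb_mul (μ := μ) X fun _ => 1

lemma ent_eq_sum [Fintype α] (q : ℕ) (X : Ω → α) :
    ent q μ X = -∑ ω, μ ω * Real.logb q (prb μ X (X ω)) := by
  rw [ent, sum_prb_mul X fun s => Real.logb q (prb μ X s)]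

lemma prb_apply_le_of_determinedBy (hμ : ∀ ω, 0 ≤ μ ω) {X : Ω → α} {Y : Ω → β}
    (h : DeterminedBy μ X Y) {ω : Ω} (hω : 0 < μ ω) :
    prb μ Y (Y ω) ≤ prb μ X (X ω) := by
  rw [prb, prb, Finset.sum_filter, Finset.sum_filter]
  refine Finset.sum_le_sum fun ω' _ => ?_
  rcases (hμ ω').eq_or_lt with h0 | h0
  · simp [← h0]
  · by_cases hY : Y ω' = Y ω
    · rw [if_pos hY, if_pos (h h0 hω hY)]
    · rw [if_neg hY]
      split_ifs <;> simp [h0.le]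

lemma ent_le_of_determinedBy [Fintype α] [Fintype β] {q : ℕ} (hq : 1 < q)
    (hμ : ∀ ω, 0 ≤ μ ω) {X : Ω → α} {Y : Ω → β} (h : DeterminedBy μ X Y) :
    ent q μ X ≤ ent q μ Y := by
  rw [ent_eq_sum, ent_eq_sum, neg_le_neg_iff]
  refine Finset.sum_le_sum fun ω _ => ?_
  rcases (hμ ω).eq_or_lt with h0 | h0
  · simp [← h0]
  · exact mul_le_mul_of_nonneg_left
      (Real.logb_le_logb_of_le (by exact_mod_cast hq) (h0.trans_le (le_prb_apply hμ Y ω))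
        (prb_apply_le_of_determinedBy hμ h h0)) h0.le

lemma determinedBy_of_condEnt_eq_zero [Fintype α] [Fintype β] {q : ℕ} (hq : 1 < q)
    (hμ : ∀ ω, 0 ≤ μ ω) {X : Ω → α} {Y : Ω → β} (h : condEnt q μ X Y = 0) :
    DeterminedBy μ X Y := by
  have hq' : (1 : ℝ) < q := by exact_mod_cast hq
  have hdet : DeterminedBy μ Y fun ω => (X ω, Y ω) := fun _ _ _ _ e => congrArg Prod.snd e
  have hterm : ∀ ω ∈ Finset.univ, μ ω * Real.logb q (prb μ (fun ω => (X ω, Y ω)) (X ω, Y ω)) ≤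
      μ ω * Real.logb q (prb μ Y (Y ω)) := fun ω _ => by
    rcases (hμ ω).eq_or_lt with h0 | h0
    · simp [← h0]
    · exact mul_le_mul_of_nonneg_left
        (Real.logb_le_logb_of_le hq' (h0.trans_le (le_prb_apply hμ (fun ω => (X ω, Y ω)) ω))
          (prb_apply_le_of_determinedBy hμ hdet h0)) h0.le
  have hsum : ∑ ω, μ ω * Real.logb q (prb μ (fun ω => (X ω, Y ω)) (X ω, Y ω)) =
      ∑ ω, μ ω * Real.logb q (prb μ Y (Y ω)) := by
    rw [condEnt, ent_eq_sum, ent_eq_sum] at h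
    linarith
  have heq := (Finset.sum_eq_sum_iff_of_le hterm).mp hsum
  intro ω ω' hω hω' hY
  by_contra hX
  have hlt : prb μ (fun ω => (X ω, Y ω)) (X ω, Y ω) < prb μ Y (Y ω) := by
    refine Finset.sum_lt_sum_of_subset (i := ω') ?_ ?_ ?_ hω' fun i _ _ => hμ i
    · intro i
      simp +contextual
    · simp [hY]
    · simp [Ne.symm hX]
  exact (mul_lt_mul_of_pos_left (Real.logb_lt_logb hq'
    (hω.trans_le (le_prb_apply hμ (fun ω => (X ω, Y ω)) ω)) hlt) hω).ne
    (heq ω (Finset.mem_univ ω))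

/-- Gibbs' inequality. -/
lemma ent_le_neg_sum_logb [Fintype α] {q : ℕ} (hq : 1 < q) (hμ : ∀ ω, 0 ≤ μ ω)
    (hμ1 : ∑ ω, μ ω = 1) (X : Ω → α) (r : α → ℝ) (hr : ∀ s, 0 ≤ r s) (hr1 : ∑ s, r s ≤ 1)
    (hpos : ∀ ω, 0 < μ ω → 0 < r (X ω)) :
    ent q μ X ≤ -∑ ω, μ ω * Real.logb q (r (X ω)) := by
  have hlog : 0 < Real.log q := Real.log_pos (by exact_mod_cast hq)
  have hterm : ∀ ω ∈ Finset.univ,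
      μ ω * Real.logb q (r (X ω)) - μ ω * Real.logb q (prb μ X (X ω)) ≤
      (μ ω * (r (X ω) / prb μ X (X ω)) - μ ω) / Real.log q := fun ω _ => by
    rcases (hμ ω).eq_or_lt with h0 | h0
    · simp [← h0]
    · have hp := h0.trans_le (le_prb_apply hμ X ω)
      have hlr := Real.log_le_sub_one_of_pos (div_pos (hpos ω h0) hp)
      rw [Real.log_div (hpos ω h0).ne' hp.ne'] at hlr
      rw [Real.logb, Real.logb, ← mul_sub, ← sub_div, ← mul_div_assoc]
      refine div_le_div_of_nonneg_right ?_ hlog.le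
      nlinarith [mul_le_mul_of_nonneg_left hlr h0.le]
  have hratio : ∑ ω, μ ω * (r (X ω) / prb μ X (X ω)) ≤ 1 := by
    rw [← sum_prb_mul X fun s => r s / prb μ X s]
    refine (Finset.sum_le_sum fun s _ => ?_).trans hr1
    rcases (prb_nonneg hμ X s).eq_or_lt with h0 | h0
    · simpa [← h0] using hr s
    · rw [mul_div_cancel₀ _ h0.ne']
  have hsum := Finset.sum_le_sum hterm
  rw [Finset.sum_sub_distrib, ← Finset.sum_div, Finset.sum_sub_distrib, hμ1] at hsum
  have := div_nonpos_of_nonpos_of_nonneg (sub_nonpos.mpr hratio) hlog.le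
  rw [ent_eq_sum]
  linarith

lemma ent_prod_le_add [Fintype α] [Fintype β] {q : ℕ} (hq : 1 < q) (hμ : ∀ ω, 0 ≤ μ ω)
    (hμ1 : ∑ ω, μ ω = 1) (X : Ω → α) (Y : Ω → β) :
    ent q μ (fun ω => (X ω, Y ω)) ≤ ent q μ X + ent q μ Y := by
  have hX : ∀ ω, 0 < μ ω → 0 < prb μ X (X ω) := fun ω h => h.trans_le (le_prb_apply hμ X ω)
  have hY : ∀ ω, 0 < μ ω → 0 < prb μ Y (Y ω) := fun ω h => h.trans_le (le_prb_apply hμ Y ω)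
  refine (ent_le_neg_sum_logb hq hμ hμ1 _ (fun s : α × β => prb μ X s.1 * prb μ Y s.2)
    (fun s => mul_nonneg (prb_nonneg hμ _ _) (prb_nonneg hμ _ _)) ?_
    fun ω h => mul_pos (hX ω h) (hY ω h)).trans_eq ?_
  · rw [Fintype.sum_prod_type]
    simp only [← Finset.mul_sum, sum_prb, hμ1, mul_one, le_refl]
  · rw [ent_eq_sum, ent_eq_sum, ← neg_add, ← Finset.sum_add_distrib]
    congr 1
    refine Finset.sum_congr rfl fun ω _ => ?_
    rcases (hμ ω).eq_or_lt with h0 | h0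
    · simp [← h0]
    · rw [Real.logb_mul (hX ω h0).ne' (hY ω h0).ne', mul_add]

lemma ent_le_logb_card [Fintype α] {q : ℕ} (hq : 1 < q) (hμ : ∀ ω, 0 ≤ μ ω)
    (hμ1 : ∑ ω, μ ω = 1) (X : Ω → α) : ent q μ X ≤ Real.logb q (Fintype.card α) := by
  have hcard : ∀ ω : Ω, 0 < ((Fintype.card α : ℝ))⁻¹ := fun ω =>
    inv_pos.mpr (by exact_mod_cast Fintype.card_pos_iff.mpr ⟨X ω⟩)
  refine (ent_le_neg_sum_logb hq hμ hμ1 X (fun _ => (Fintype.card α : ℝ)⁻¹)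
    (fun _ => by positivity) ?_ fun ω _ => hcard ω).trans_eq ?_
  · simpa using mul_inv_le_one
  · rw [← Finset.sum_mul, hμ1, Real.logb_inv]
    ring

lemma ent_le_length {F : Type} [Fintype F] (hF : 1 < Fintype.card F) (hμ : ∀ ω, 0 ≤ μ ω)
    (hμ1 : ∑ ω, μ ω = 1) {n : ℕ} (X : Ω → Fin n → F) : ent (Fintype.card F) μ X ≤ n := by
  refine (ent_le_logb_card hF hμ hμ1 X).trans_eq ?_
  have hF' : (1 : ℝ) < Fintype.card F := by exact_mod_cast hF
  rw [Fintype.card_fun, Fintype.card_fin, Nat.cast_pow, Real.logb_pow,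
    Real.logb_self_eq_one hF', mul_one]

lemma ent_restr_le {F ι : Type} [Fintype F] [DecidableEq ι] (hF : 1 < Fintype.card F)
    (hμ : ∀ ω, 0 ≤ μ ω) (hμ1 : ∑ ω, μ ω = 1) {n : ℕ} (W : ι → Ω → Fin n → F) (T : Finset ι) :
    ent (Fintype.card F) μ (restr W T) ≤ T.card * n := by
  refine (ent_le_logb_card hF hμ hμ1 _).trans_eq ?_
  have hF' : (1 : ℝ) < Fintype.card F := by exact_mod_cast hF
  rw [Fintype.card_fun, Fintype.card_fun, Fintype.card_fin, Fintype.card_coe, Nat.cast_pow,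
    Nat.cast_pow, Real.logb_pow, Real.logb_pow, Real.logb_self_eq_one hF', mul_one]

lemma restr_eq_restr_iff {Ω ι α : Type} {Z : ι → Ω → α} {T : Finset ι} {ω ω' : Ω} :
    restr Z T ω = restr Z T ω' ↔ ∀ i ∈ T, Z i ω = Z i ω' := by
  simp [restr, funext_iff]

/-- If the inputs are independent, uniform and independent of the keys, then a message which,
together with the keys and all inputs but one, determines the sum of the inputs is at least as
long as an input. -/
lemma length_le_of_determinedBy_sum {F ι : Type} [Field F] [Fintype F] [Fintype ι]
    [DecidableEq ι]
    (hμ : ∀ ω, 0 ≤ μ ω) (hμ1 : ∑ ω, μ ω = 1) {L LZ n : ℕ}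
    {W : ι → Ω → Fin L → F} {Z : ι → Ω → Fin LZ → F}
    (hWent : ∀ i, ent (Fintype.card F) μ (W i) = L)
    (hInd : ent (Fintype.card F) μ (fun ω => (restr W Finset.univ ω, restr Z Finset.univ ω)) =
      ent (Fintype.card F) μ (restr Z Finset.univ) + ∑ i, ent (Fintype.card F) μ (W i))
    (i : ι) (M : Ω → Fin n → F)
    (hdet : DeterminedBy μ (fun ω => ∑ j, W j ω)
      fun ω => (M ω, restr W (Finset.univ.erase i) ω, restr Z Finset.univ ω)) :
    L ≤ n := by
  have hF : 1 < Fintype.card F := Fintype.one_lt_card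
  have hall : DeterminedBy μ (fun ω => (restr W Finset.univ ω, restr Z Finset.univ ω))
      fun ω => (M ω, restr W (Finset.univ.erase i) ω, restr Z Finset.univ ω) := by
    intro ω ω' hω hω' e
    have hsum := hdet hω hω' e
    simp only [Prod.mk.injEq, restr_eq_restr_iff] at e hsum ⊢
    refine ⟨fun j _ => ?_, e.2.2⟩
    by_cases hj : j = i
    · subst hj
      rw [← Finset.add_sum_erase _ _ (Finset.mem_univ j),
        ← Finset.add_sum_erase _ (fun k => W k ω') (Finset.mem_univ j),
        Finset.sum_congr rfl e.2.1] at hsum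
      exact add_right_cancel hsum
    · exact e.2.1 j (by simp [hj])
  have h1 := ent_le_of_determinedBy hF hμ hall
  have h2 := ent_prod_le_add hF hμ hμ1 M
    fun ω => (restr W (Finset.univ.erase i) ω, restr Z Finset.univ ω)
  have h3 := ent_prod_le_add hF hμ hμ1 (restr W (Finset.univ.erase i)) (restr Z Finset.univ)
  have h4 := ent_restr_le hF hμ hμ1 W (Finset.univ.erase i)
  have h5 := ent_le_length hF hμ hμ1 M
  have hcard : (((Finset.univ.erase i).card : ℕ) : ℝ) + 1 = Fintype.card ι := by
    exact_mod_cast Finset.card_erase_add_one (Finset.mem_univ i)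
  have hsumW : ∑ j, ent (Fintype.card F) μ (W j) = Fintype.card ι * L := by
    simp [hWent]
  rw [hInd, hsumW, ← hcard, add_mul, one_mul] at h1
  have : (L : ℝ) ≤ n := by linarith
  exact_mod_cast this

end Entropy

theorem stmt6_communication_rates
    (U : ℕ) (hU : 3 ≤ U) (V : Fin U → ℕ) (hV : ∀ u, 1 ≤ V u)
    (F : Type) [Field F] [Fintype F] (Ω : Type) [Fintype Ω] (μ : Ω → ℝ)
    (hμ0 : ∀ ω, 0 ≤ μ ω) (hμ1 : ∑ ω, μ ω = 1)
    (L LX LY LZ : ℕ) (hL : 1 ≤ L)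
    (W : Usr U V → Ω → Fin L → F) (Z : Usr U V → Ω → Fin LZ → F)
    (X : Usr U V → Ω → Fin LX → F) (Y : Fin U → Ω → Fin LY → F)
    (hWent : ∀ i, ent (Fintype.card F) μ (W i) = L)
    (hInd : ent (Fintype.card F) μ (fun ω => (restr W Finset.univ ω, restr Z Finset.univ ω)) =
      ent (Fintype.card F) μ (restr Z Finset.univ) + ∑ i, ent (Fintype.card F) μ (W i))
    (hX : ∀ i, condEnt (Fintype.card F) μ (X i) (fun ω => (W i ω, Z i ω)) = 0)
    (hY : ∀ u, condEnt (Fintype.card F) μ (Y u) (restr X (Ksrv U V u)) = 0)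
    (hCorr : ∀ k, condEnt (Fintype.card F) μ (fun ω => ∑ i, W i ω)
      (fun ω => (restr Y (Finset.univ.erase k) ω, restr X (Ksrv U V k) ω)) = 0) :
    L ≤ LX ∧ L ≤ LY ∧ (1 : ℝ) ≤ (LX : ℝ) / (L : ℝ) ∧ (1 : ℝ) ≤ (LY : ℝ) / (L : ℝ) := by
  have hF : 1 < Fintype.card F := Fintype.one_lt_card
  have hXd := fun i => determinedBy_of_condEnt_eq_zero hF hμ0 (hX i)
  have hYd := fun u => determinedBy_of_condEnt_eq_zero hF hμ0 (hY u)
  have hCd := fun k => determinedBy_of_condEnt_eq_zero hF hμ0 (hCorr k)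
  let u₀ : Fin U := ⟨0, by omega⟩
  let u₁ : Fin U := ⟨1, by omega⟩
  have hne : u₀ ≠ u₁ := by simp [u₀, u₁]
  let i₀ : Usr U V := ⟨u₀, ⟨0, hV u₀⟩⟩
  have hXeq : ∀ {ω ω'}, 0 < μ ω → 0 < μ ω' →
      restr W (Finset.univ.erase i₀) ω = restr W (Finset.univ.erase i₀) ω' →
      restr Z Finset.univ ω = restr Z Finset.univ ω' → ∀ i, i ≠ i₀ → X i ω = X i ω' := by
    intro ω ω' hω hω' hw hz i hi
    rw [restr_eq_restr_iff] at hw hz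
    exact hXd i hω hω' (Prod.ext (hw i (by simp [hi])) (hz i (Finset.mem_univ i)))
  have hYeq : ∀ {ω ω'}, 0 < μ ω → 0 < μ ω' →
      restr W (Finset.univ.erase i₀) ω = restr W (Finset.univ.erase i₀) ω' →
      restr Z Finset.univ ω = restr Z Finset.univ ω' → ∀ u, u ≠ u₀ → Y u ω = Y u ω' := by
    intro ω ω' hω hω' hw hz u hu
    refine hYd u hω hω' (restr_eq_restr_iff.mpr fun i hi => hXeq hω hω' hw hz i ?_)
    rintro rfl
    exact hu (Finset.mem_filter.mp hi).2.symm
  have hLX : L ≤ LX := by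
    refine length_le_of_determinedBy_sum hμ0 hμ1 hWent hInd i₀ (X i₀) fun ω ω' hω hω' e => ?_
    simp only [Prod.mk.injEq] at e
    obtain ⟨hm, hw, hz⟩ := e
    refine hCd u₀ hω hω' (Prod.ext ?_ ?_) <;> refine restr_eq_restr_iff.mpr ?_
    · exact fun u hu => hYeq hω hω' hw hz u (Finset.ne_of_mem_erase hu)
    · intro i _
      by_cases hi : i = i₀
      · rw [hi, hm]
      · exact hXeq hω hω' hw hz i hi
  have hLY : L ≤ LY := by
    refine length_le_of_determinedBy_sum hμ0 hμ1 hWent hInd i₀ (Y u₀) fun ω ω' hω hω' e => ?_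
    simp only [Prod.mk.injEq] at e
    obtain ⟨hm, hw, hz⟩ := e
    refine hCd u₁ hω hω' (Prod.ext ?_ ?_) <;> refine restr_eq_restr_iff.mpr ?_
    · intro u _
      by_cases hu : u = u₀
      · rw [hu, hm]
      · exact hYeq hω hω' hw hz u hu
    · intro i hi
      refine hXeq hω hω' hw hz i ?_
      rintro rfl
      exact hne (Finset.mem_filter.mp hi).2
  have hL0 : (0 : ℝ) < L := by exact_mod_cast hL
  refine ⟨hLX, hLY, ?_, ?_⟩
  · rw [one_le_div hL0]
    exact_mod_cast hLX
  · rw [one_le_div hL0]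
    exact_mod_cast hLY
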